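/- Let p be an odd prime, f : ℤ_p → ℤ_p continuous, λ ∈ ℚ_p with ‖λ‖_p > 1, and n ∈ ℕ with n ≥ 1. Then both fermionic integrals below exist and ζ_{p,E}^f(1−n,λ) = ω_v(λ)^{−n}·E_n^f(λ); explicitly, lim_{N→∞} Σ_{a=0}^{p^N−1} (−1)^a ⟨λ+f(a)⟩^n = ω_v(λ)^{−n} · lim_{N→∞} Σ_{a=0}^{p^N−1} (−1)^a (λ+f(a))^n. -/

import Mathlib

open Filter Topology

namespace PZeta

variable (p : ℕ) [Fact p.Prime]

/-- The `N`-th partial sum defining the fermionic integral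
`∫_{ℤ_p} g dμ₋₁ = lim_N Σ_{a=0}^{p^N-1} (-1)^a g(a)`. -/
noncomputable def fermSum (g : ℤ_[p] → ℚ_[p]) (N : ℕ) : ℚ_[p] :=
  ∑ a ∈ Finset.range (p ^ N), (-1 : ℚ_[p]) ^ a * g (a : ℤ_[p])

/-- The `N`-th partial sum defining the Volkenborn integral
`∫_{ℤ_p} g da = lim_N p^{-N} Σ_{a=0}^{p^N-1} g(a)`. -/
noncomputable def volkSum (g : ℤ_[p] → ℚ_[p]) (N : ℕ) : ℚ_[p] :=
  ((p : ℚ_[p]) ^ N)⁻¹ * ∑ a ∈ Finset.range (p ^ N), g (a : ℤ_[p])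

/-- The unit part `x·p^{-v_p(x)}` of a nonzero `p`-adic number. -/
noncomputable def unitPart (x : ℚ_[p]) : ℚ_[p] := x * (p : ℚ_[p]) ^ (-x.valuation)

/-- The Teichmüller representative of a `p`-adic unit, `lim_n x^{p^n}`. -/
noncomputable def teich (x : ℚ_[p]) : ℚ_[p] :=
  limUnder atTop fun n : ℕ => x ^ p ^ n

/-- The projection `⟨x⟩ ∈ 1 + pℤ_p`, via `x = p^{v_p(x)}·ζ·⟨x⟩`. -/
noncomputable def angle (x : ℚ_[p]) : ℚ_[p] := unitPart p x / teich p (unitPart p x)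

/-- `ω_v(x) := x / ⟨x⟩ = p^{v_p(x)}·ζ`. -/
noncomputable def omegaV (x : ℚ_[p]) : ℚ_[p] := x / angle p x

/-- The generalized binomial coefficient `C(t,n) = t(t-1)⋯(t-n+1)/n!`. -/
noncomputable def gbinom (t : ℚ_[p]) (n : ℕ) : ℚ_[p] :=
  (∏ i ∈ Finset.range n, (t - (i : ℚ_[p]))) / (n.factorial : ℚ_[p])

/-- The power `y^t` defined by the binomial series `Σ_n C(t,n)(y-1)^n`
(used for `y ∈ 1 + pℤ_p` and `t ∈ ℤ_p`). -/
noncomputable def bpow (y t : ℚ_[p]) : ℚ_[p] := ∑' n : ℕ, gbinom p t n * (y - 1) ^ n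

/-- The Iwasawa `p`-adic logarithm: `log_p x = Σ_{n≥1} (-1)^{n+1}(⟨x⟩-1)^n/n`
(one has `log_p p = 0` and `log_p ζ = 0` for roots of unity of order prime to `p`). -/
noncomputable def padicLog (x : ℚ_[p]) : ℚ_[p] :=
  ∑' n : ℕ, (-1 : ℚ_[p]) ^ n * (angle p x - 1) ^ (n + 1) / ((n : ℚ_[p]) + 1)

/-- The power `y^t` defined by the exponential series `Σ_n (t·log_p y)^n/n!`
(used for `y ∈ 1 + pℤ_p` and `‖t‖ < p^{(p-2)/(p-1)}`). -/
noncomputable def epow (y t : ℚ_[p]) : ℚ_[p] :=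
  ∑' n : ℕ, (t * padicLog p y) ^ n / (n.factorial : ℚ_[p])

/-- `f : ℤ_p → ℤ_p` is everywhere analytic with integral coefficients:
`f(x) = Σ_k c_k x^k` with `‖c_k‖ ≤ 1`, `c_k → 0`. -/
def EverywhereAnalytic (f : ℤ_[p] → ℤ_[p]) : Prop :=
  ∃ c : ℕ → ℚ_[p], (∀ k, ‖c k‖ ≤ 1) ∧ Tendsto c atTop (𝓝 0) ∧
    ∀ x : ℤ_[p], (f x : ℚ_[p]) = ∑' k : ℕ, c k * (x : ℚ_[p]) ^ k

/-- The `p`-adic Hurwitz-type Euler zeta function w.r.t. `f`: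
`ζ_{p,E}^f(s,λ) = ∫_{ℤ_p} ⟨λ+f(a)⟩^{1-s} dμ₋₁(a)`. -/
noncomputable def zetaE (f : ℤ_[p] → ℤ_[p]) (s : ℤ_[p]) (lam : ℚ_[p]) : ℚ_[p] :=
  limUnder atTop
    (fermSum p fun a => bpow p (angle p (lam + (f a : ℚ_[p]))) (1 - (s : ℚ_[p])))

/-- The `p`-adic Hurwitz zeta function w.r.t. `f`:
`ζ_p^f(s,λ) = (s-1)⁻¹ ∫_{ℤ_p} ⟨λ+f(a)⟩^{1-s} da`. -/
noncomputable def zetaH (f : ℤ_[p] → ℤ_[p]) (s : ℤ_[p]) (lam : ℚ_[p]) : ℚ_[p] :=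
  ((s : ℚ_[p]) - 1)⁻¹ *
    limUnder atTop
      (volkSum p fun a => bpow p (angle p (lam + (f a : ℚ_[p]))) (1 - (s : ℚ_[p])))

end PZeta

open PZeta

namespace PZeta

section FermionicIntegral

variable {p : ℕ} [Fact p.Prime]

lemma norm_neg_one_pow_mul (a : ℕ) (x : ℚ_[p]) : ‖(-1 : ℚ_[p]) ^ a * x‖ = ‖x‖ := by
  simp

lemma sum_range_mul_eq {M : Type*} [AddCommMonoid M] (h : ℕ → M) (m k : ℕ) :
    ∑ a ∈ Finset.range (m * k), h a =
      ∑ j ∈ Finset.range k, ∑ a ∈ Finset.range m, h (m * j + a) := by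
  induction k with
  | zero => simp
  | succ k ih => rw [mul_add_one, Finset.sum_range_add, ih, Finset.sum_range_succ]

lemma sum_range_neg_one_pow_of_odd {R : Type*} [CommRing R] {k : ℕ} (hk : Odd k) :
    ∑ j ∈ Finset.range k, (-1 : R) ^ j = 1 := by
  rw [neg_one_geom_sum, if_neg (Nat.not_even_iff_odd.mpr hk)]

lemma fermSum_succ_sub (hp : Odd p) (g : ℤ_[p] → ℚ_[p]) (N : ℕ) :
    fermSum p g (N + 1) - fermSum p g N =
      ∑ j ∈ Finset.range p, ∑ a ∈ Finset.range (p ^ N), (-1 : ℚ_[p]) ^ j *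
        ((-1 : ℚ_[p]) ^ a * (g ((p ^ N * j + a : ℕ) : ℤ_[p]) - g (a : ℤ_[p]))) := by
  have hsum : fermSum p g N = ∑ j ∈ Finset.range p, ∑ a ∈ Finset.range (p ^ N),
      (-1 : ℚ_[p]) ^ j * ((-1 : ℚ_[p]) ^ a * g (a : ℤ_[p])) := by
    simp_rw [← Finset.mul_sum]
    rw [← Finset.sum_mul, sum_range_neg_one_pow_of_odd hp, one_mul, fermSum]
  rw [hsum, fermSum, pow_succ, sum_range_mul_eq, ← Finset.sum_sub_distrib]
  refine Finset.sum_congr rfl fun j _ => ?_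
  rw [← Finset.sum_sub_distrib]
  refine Finset.sum_congr rfl fun a _ => ?_
  rw [pow_add, pow_mul, hp.pow.neg_one_pow]
  ring

/-- The fermionic integral of a continuous function exists. -/
lemma exists_tendsto_fermSum (hp : Odd p) {g : ℤ_[p] → ℚ_[p]} (hg : Continuous g) :
    ∃ L, Tendsto (fermSum p g) atTop (𝓝 L) := by
  refine cauchySeq_tendsto_of_complete
    (NonarchimedeanAddGroup.cauchySeq_of_tendsto_sub_nhds_zero ?_)
  rw [Metric.tendsto_atTop]
  intro ε hε
  obtain ⟨δ, hδ, hgδ⟩ := Metric.uniformContinuous_iff.mp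
    (CompactSpace.uniformContinuous_of_continuous hg) (ε / 2) (half_pos hε)
  obtain ⟨N₀, hN₀⟩ := PadicInt.exists_pow_neg_lt p hδ
  refine ⟨N₀, fun N hN => ?_⟩
  rw [dist_zero_right, fermSum_succ_sub hp]
  refine lt_of_le_of_lt ?_ (half_lt_self hε)
  refine IsUltrametricDist.norm_sum_le_of_forall_le_of_nonneg (half_pos hε).le fun j _ => ?_
  refine IsUltrametricDist.norm_sum_le_of_forall_le_of_nonneg (half_pos hε).le fun a _ => ?_
  rw [norm_neg_one_pow_mul, norm_neg_one_pow_mul, ← dist_eq_norm]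
  refine (hgδ ?_).le
  have hp1 : (1 : ℝ) ≤ p := mod_cast (Fact.out : p.Prime).one_le
  rw [dist_eq_norm]
  push_cast
  rw [add_sub_cancel_right, norm_mul, PadicInt.norm_p_pow]
  calc (p : ℝ) ^ (-N : ℤ) * ‖(j : ℤ_[p])‖ ≤ (p : ℝ) ^ (-N : ℤ) :=
        mul_le_of_le_one_right (by positivity) (PadicInt.norm_le_one _)
    _ ≤ (p : ℝ) ^ (-N₀ : ℤ) := zpow_le_zpow_right₀ hp1 (by lia)
    _ < δ := hN₀

lemma fermSum_const_mul (c : ℚ_[p]) (g : ℤ_[p] → ℚ_[p]) (N : ℕ) :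
    fermSum p (fun a => c * g a) N = c * fermSum p g N := by
  simp only [fermSum, Finset.mul_sum]
  exact Finset.sum_congr rfl fun a _ => by ring

end FermionicIntegral

section Angle

variable {p : ℕ} [Fact p.Prime]

lemma tendsto_pow_pow_sub_pow_pow {x y : ℚ_[p]} (hx : ‖x‖ ≤ 1) (hy : ‖y‖ ≤ 1)
    (hxy : ‖x - y‖ < 1) :
    Tendsto (fun n : ℕ => x ^ p ^ n - y ^ p ^ n) atTop (𝓝 0) := by
  obtain ⟨x, rfl⟩ : ∃ z : ℤ_[p], (z : ℚ_[p]) = x := ⟨⟨x, hx⟩, rfl⟩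
  obtain ⟨y, rfl⟩ : ∃ z : ℤ_[p], (z : ℚ_[p]) = y := ⟨⟨y, hy⟩, rfl⟩
  have hdvd : (p : ℤ_[p]) ∣ x - y := by
    rwa [← PadicInt.norm_lt_one_iff_dvd, PadicInt.norm_def, PadicInt.coe_sub]
  have hp1 : (p : ℝ)⁻¹ < 1 := inv_lt_one_of_one_lt₀ (mod_cast (Fact.out : p.Prime).one_lt)
  refine squeeze_zero_norm (fun n => ?_) ((tendsto_add_atTop_iff_nat 1).mpr
    (tendsto_pow_atTop_nhds_zero_of_lt_one (inv_nonneg.mpr p.cast_nonneg) hp1))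
  have h : ‖x ^ p ^ n - y ^ p ^ n‖ ≤ (p : ℝ) ^ (-(n + 1 : ℕ) : ℤ) := by
    rw [PadicInt.norm_le_pow_iff_mem_span_pow, Ideal.mem_span_singleton]
    exact dvd_sub_pow_of_dvd_sub hdvd n
  rw [inv_pow, ← zpow_natCast (p : ℝ), ← zpow_neg]
  simpa only [PadicInt.norm_def, PadicInt.coe_sub, PadicInt.coe_pow] using h

/-- The Teichmüller representative depends only on the residue class. -/
lemma teich_eq_of_norm_sub_lt_one {x y : ℚ_[p]} (hx : ‖x‖ ≤ 1) (hy : ‖y‖ ≤ 1)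
    (hxy : ‖x - y‖ < 1) : teich p x = teich p y := by
  have h := tendsto_pow_pow_sub_pow_pow hx hy hxy
  have hiff (z : ℚ_[p]) : Tendsto (fun n : ℕ => x ^ p ^ n) atTop (𝓝 z) ↔
      Tendsto (fun n : ℕ => y ^ p ^ n) atTop (𝓝 z) :=
    ⟨fun hz => by simpa using hz.sub h, fun hz => by simpa using hz.add h⟩
  have hfun : (fun z => map (fun n : ℕ => x ^ p ^ n) atTop ≤ 𝓝 z) =
      fun z => map (fun n : ℕ => y ^ p ^ n) atTop ≤ 𝓝 z :=
    funext fun z => propext (hiff z)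
  simp only [teich, limUnder, lim, hfun]

lemma valuation_eq_of_norm_eq {x y : ℚ_[p]} (hx : x ≠ 0) (hxy : ‖x‖ = ‖y‖) :
    x.valuation = y.valuation := by
  have hy : y ≠ 0 := by rwa [← norm_ne_zero_iff, ← hxy, norm_ne_zero_iff]
  rw [Padic.norm_eq_zpow_neg_valuation hx, Padic.norm_eq_zpow_neg_valuation hy] at hxy
  have hp1 : (1 : ℝ) < p := mod_cast (Fact.out : p.Prime).one_lt
  exact neg_injective (zpow_right_injective₀ (by linarith) hp1.ne' hxy)

lemma norm_zpow_neg_valuation {x : ℚ_[p]} (hx : x ≠ 0) :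
    ‖(p : ℚ_[p]) ^ (-x.valuation)‖ = ‖x‖⁻¹ := by
  rw [Padic.norm_p_zpow, Padic.norm_eq_zpow_neg_valuation hx, zpow_neg]

lemma norm_unitPart {x : ℚ_[p]} (hx : x ≠ 0) : ‖unitPart p x‖ = 1 := by
  rw [unitPart, norm_mul, norm_zpow_neg_valuation hx, mul_inv_cancel₀ (norm_ne_zero_iff.mpr hx)]

/-- `⟨x + y⟩ = (x + y) / ω_v(x)` when `‖y‖ < ‖x‖`. -/
lemma angle_add_of_norm_lt {x y : ℚ_[p]} (hxy : ‖y‖ < ‖x‖) :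
    angle p (x + y) = (omegaV p x)⁻¹ * (x + y) := by
  have hnorm : ‖x + y‖ = ‖x‖ := by
    rw [Padic.add_eq_max_of_ne hxy.ne', max_eq_left hxy.le]
  have hx : x ≠ 0 := norm_pos_iff.mp ((norm_nonneg y).trans_lt hxy)
  have hxy0 : x + y ≠ 0 := by rwa [← norm_ne_zero_iff, hnorm, norm_ne_zero_iff]
  have hval : (x + y).valuation = x.valuation := valuation_eq_of_norm_eq hxy0 hnorm
  have hsub : ‖unitPart p (x + y) - unitPart p x‖ < 1 := by
    rw [unitPart, unitPart, hval, ← sub_mul, add_sub_cancel_left, norm_mul,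
      norm_zpow_neg_valuation hx, ← div_eq_mul_inv]
    exact (div_lt_one (norm_pos_iff.mpr hx)).mpr hxy
  have hteich := teich_eq_of_norm_sub_lt_one (norm_unitPart hxy0).le (norm_unitPart hx).le hsub
  rw [omegaV, angle, angle, hteich, unitPart, hval, unitPart, inv_div]
  field_simp

end Angle

end PZeta

/-- special values of `ζ_{p,E}^f` at non-positive integers: for `n ≥ 1` both
fermionic integrals `L = ∫_{ℤ_p} ⟨λ+f(a)⟩^n dμ₋₁(a)` (i.e. `ζ_{p,E}^f(1-n,λ)`) and
`M = ∫_{ℤ_p} (λ+f(a))^n dμ₋₁(a)` (i.e. `E_n^f(λ)`) exist, and `L = ω_v(λ)^{-n}·M`. -/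
theorem zetaE_special_values (p : ℕ) [Fact p.Prime] (hp : Odd p)
    (f : ℤ_[p] → ℤ_[p]) (hf : Continuous f)
    (lam : ℚ_[p]) (hlam : 1 < ‖lam‖) (n : ℕ) (hn : 1 ≤ n) :
    ∃ L M : ℚ_[p],
      Filter.Tendsto (fermSum p fun a => (angle p (lam + (f a : ℚ_[p]))) ^ n)
        Filter.atTop (nhds L) ∧
      Filter.Tendsto (fermSum p fun a => (lam + (f a : ℚ_[p])) ^ n)
        Filter.atTop (nhds M) ∧
      L = ((omegaV p lam) ^ n)⁻¹ * M := by
  have hfactor : (fun a => angle p (lam + (f a : ℚ_[p])) ^ n) =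
      fun a => ((omegaV p lam) ^ n)⁻¹ * (lam + (f a : ℚ_[p])) ^ n := by
    funext a
    rw [angle_add_of_norm_lt ((PadicInt.norm_le_one (f a)).trans_lt hlam), mul_pow, inv_pow]
  have hcont : Continuous fun a => (lam + (f a : ℚ_[p])) ^ n :=
    (continuous_const.add (continuous_subtype_val.comp hf)).pow n
  obtain ⟨M, hM⟩ := exists_tendsto_fermSum hp hcont
  refine ⟨((omegaV p lam) ^ n)⁻¹ * M, M, ?_, hM, rfl⟩
  rw [hfactor]
  exact (hM.const_mul _).congr fun N => (fermSum_const_mul _ _ N).symm
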